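/- arXiv:2008.09733 — 2 statements merged into one kernel-verified Lean document; each statement's English description precedes it below -/
import Mathlib

section
/- Let S be an ordering of the N items such that (i) whenever item i precedes item j in S and C(i) = C(j), one has u_i ≥ u_j, and (ii) the attractiveness values are nonincreasing along S, i.e., z_{S_1}(S) ≥ z_{S_2}(S) ≥ … ≥ z_{S_N}(S). Then S maximizes the expected reward: for every ordering S' of the N items, E[R(S)] ≥ E[R(S')]. (This is exactly the ordering produced by Algorithm 1: within each category sort items by decreasing relevance, assign to the item of within-category rank r+1 the score λ = f(r)·u, and sort all items by decreasing λ.) -/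
/-- Expected reward `R_{g,q}` of a list of attractiveness values. -/
def reward (g q : ℝ) : List ℝ → ℝ
  | [] => 0
  | z :: rest => z + ((g - q) * z + q) * reward g q rest

/-- Auxiliary: attractiveness values of the items in `S`, given that the
items in `prev` have already been shown. -/
def attrAux {N K : ℕ} (f : ℕ → ℝ) (u : Fin N → ℝ) (C : Fin N → Fin K) :
    List (Fin N) → List (Fin N) → List ℝ
  | _, [] => []
  | prev, i :: rest =>
      f (prev.countP (fun j => decide (C j = C i))) * u i ::
        attrAux f u C (prev ++ [i]) rest

/-- The list of attractiveness values `z_{S_1}(S), …, z_{S_N}(S)` of an ordering `S`. -/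
def attrList {N K : ℕ} (f : ℕ → ℝ) (u : Fin N → ℝ) (C : Fin N → Fin K)
    (S : List (Fin N)) : List ℝ :=
  attrAux f u C [] S

section Reward

variable {g q : ℝ}

lemma continuation_mem_Icc (hq0 : 0 ≤ q) (hqg : q ≤ g) (hg1 : g ≤ 1) {z : ℝ}
    (hz : z ∈ Set.Icc (0 : ℝ) 1) : (g - q) * z + q ∈ Set.Icc (0 : ℝ) 1 := by
  obtain ⟨h0, h1⟩ := hz
  constructor <;> nlinarith

lemma reward_nonneg (hq0 : 0 ≤ q) (hqg : q ≤ g) (L : List ℝ) (hL : ∀ z ∈ L, 0 ≤ z) :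
    0 ≤ reward g q L := by
  induction L with
  | nil => exact le_rfl
  | cons z L ih =>
    obtain ⟨hz, hL⟩ := List.forall_mem_cons.mp hL
    exact add_nonneg hz (mul_nonneg
      (add_nonneg (mul_nonneg (sub_nonneg.2 hqg) hz) hq0) (ih hL))

/-- The reward of `M ++ L` is an affine function of the reward of `L`. -/
lemma exists_reward_append_eq (hq0 : 0 ≤ q) (hqg : q ≤ g) (hg1 : g ≤ 1) (M : List ℝ)
    (hM : ∀ z ∈ M, z ∈ Set.Icc (0 : ℝ) 1) :
    ∃ A B : ℝ, 0 ≤ A ∧ B ∈ Set.Icc (0 : ℝ) 1 ∧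
      ∀ L, reward g q (M ++ L) = A + B * reward g q L := by
  induction M with
  | nil => exact ⟨0, 1, le_rfl, by simp, by simp⟩
  | cons z M ih =>
    obtain ⟨hz, hM⟩ := List.forall_mem_cons.mp hM
    obtain ⟨A, B, hA, hB, h⟩ := ih hM
    have hc := continuation_mem_Icc hq0 hqg hg1 hz
    refine ⟨z + ((g - q) * z + q) * A, ((g - q) * z + q) * B,
      add_nonneg hz.1 (mul_nonneg hc.1 hA),
      ⟨mul_nonneg hc.1 hB.1, mul_le_one₀ hc.2 hB.1 hB.2⟩, fun L => ?_⟩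
    simp only [List.cons_append, reward, h]
    ring

lemma reward_cons_le_reward_cons (hq0 : 0 ≤ q) (hqg : q ≤ g) {z : ℝ} (hz : 0 ≤ z)
    {L L' : List ℝ} (h : reward g q L ≤ reward g q L') :
    reward g q (z :: L) ≤ reward g q (z :: L') := by
  have hc : 0 ≤ (g - q) * z + q := add_nonneg (mul_nonneg (sub_nonneg.2 hqg) hz) hq0
  simp only [reward]
  gcongr

lemma reward_swap_le (hqg : q ≤ g) (hg1 : g ≤ 1) {x y : ℝ} (hxy : x ≤ y) (L : List ℝ) :
    reward g q (x :: y :: L) ≤ reward g q (y :: x :: L) := by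
  simp only [reward]
  nlinarith [mul_nonneg (sub_nonneg.2 hxy) (sub_nonneg.2 (hqg.trans hg1))]

/-- Replacing two values `x`, `y` by `X`, `Y` with the same product, a larger sum and
`x ≤ X` does not decrease the reward. -/
lemma reward_spread_le (hq0 : 0 ≤ q) (hqg : q ≤ g) (hg1 : g ≤ 1) {x y X Y : ℝ}
    (hX : x ≤ X) (hsum : x + y ≤ X + Y) (hprod : x * y = X * Y) (M L : List ℝ)
    (hM : ∀ z ∈ M, z ∈ Set.Icc (0 : ℝ) 1) (hL : ∀ z ∈ L, 0 ≤ z) :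
    reward g q (x :: (M ++ y :: L)) ≤ reward g q (X :: (M ++ Y :: L)) := by
  obtain ⟨A, B, hA, ⟨hB0, hB1⟩, h⟩ := exists_reward_append_eq hq0 hqg hg1 M hM
  simp only [reward, h]
  have hT := reward_nonneg hq0 hqg L hL
  generalize reward g q L = T at hT ⊢
  have hqB : 0 ≤ 1 - q * B := by nlinarith
  have key : X + ((g - q) * X + q) * (A + B * (Y + ((g - q) * Y + q) * T)) -
      (x + ((g - q) * x + q) * (A + B * (y + ((g - q) * y + q) * T))) =
      (X - x) * (1 - q * B) + (g - q) * A * (X - x) +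
      q * B * (1 + (g - q) * T) * (X + Y - (x + y)) := by
    linear_combination (-(g - q) * B - (g - q) ^ 2 * B * T) * hprod
  have h1 := mul_nonneg (sub_nonneg.2 hX) hqB
  have h2 := mul_nonneg (mul_nonneg (sub_nonneg.2 hqg) hA) (sub_nonneg.2 hX)
  have h3 := mul_nonneg (mul_nonneg (mul_nonneg hq0 hB0)
    (add_nonneg zero_le_one (mul_nonneg (sub_nonneg.2 hqg) hT))) (sub_nonneg.2 hsum)
  linarith

end Reward

section Attractiveness

variable {N K : ℕ} {f : ℕ → ℝ} {u : Fin N → ℝ} {C : Fin N → Fin K}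

lemma attrAux_congr {p p' : List (Fin N)}
    (h : ∀ c, p.countP (fun j => decide (C j = c)) = p'.countP (fun j => decide (C j = c)))
    (L : List (Fin N)) : attrAux f u C p L = attrAux f u C p' L := by
  induction L generalizing p p' with
  | nil => rfl
  | cons i L ih =>
    simp only [attrAux, h]
    rw [ih (p := p ++ [i]) (p' := p' ++ [i]) fun c => by simp only [List.countP_append, h]]

lemma attrAux_append (p L L' : List (Fin N)) :
    attrAux f u C p (L ++ L') = attrAux f u C p L ++ attrAux f u C (p ++ L) L' := by
  induction L generalizing p with
  | nil => simp [attrAux]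
  | cons i L ih => simp [attrAux, ih]

lemma attrAux_mem_Icc (hf : ∀ r, f r ∈ Set.Icc (0 : ℝ) 1) (hu : ∀ i, u i ∈ Set.Icc (0 : ℝ) 1)
    (p L : List (Fin N)) : ∀ z ∈ attrAux f u C p L, z ∈ Set.Icc (0 : ℝ) 1 := by
  induction L generalizing p with
  | nil => simp [attrAux]
  | cons i L ih =>
    simp only [attrAux, List.forall_mem_cons]
    exact ⟨⟨mul_nonneg (hf _).1 (hu i).1, mul_le_one₀ (hf _).2 (hu i).1 (hu i).2⟩, ih _⟩

/-- In a list whose categories are sorted by relevance, a bound on the attractiveness values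
also bounds the value each item would have if it were shown first. -/
lemma head_attr_le (hf : ∀ r, 0 ≤ f r) {B : ℝ} {p L : List (Fin N)}
    (hcat : L.Pairwise (fun i j => C i = C j → u j ≤ u i))
    (hB : ∀ z ∈ attrAux f u C p L, z ≤ B) {a : Fin N} (ha : a ∈ L) :
    f (p.countP (fun j => decide (C j = C a))) * u a ≤ B := by
  induction L generalizing p with
  | nil => simp at ha
  | cons b L ih =>
    simp only [attrAux, List.forall_mem_cons] at hB
    obtain ⟨hb, hcat⟩ := List.pairwise_cons.mp hcat
    rcases List.mem_cons.mp ha with rfl | ha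
    · exact hB.1
    · by_cases h : C b = C a
      · have := hB.1
        rw [h] at this
        exact (mul_le_mul_of_nonneg_left (hb a ha h) (hf _)).trans this
      · simpa [List.countP_append, h] using ih hcat hB.2 ha

end Attractiveness

section Exchange

variable {N K : ℕ} {g q : ℝ} {f : ℕ → ℝ} {u : Fin N → ℝ} {C : Fin N → Fin K}

lemma reward_exchange_same_category_le (hq0 : 0 ≤ q) (hqg : q ≤ g) (hg1 : g ≤ 1)
    (hf_anti : Antitone f) (hf : ∀ r, f r ∈ Set.Icc (0 : ℝ) 1)
    (hu : ∀ i, u i ∈ Set.Icc (0 : ℝ) 1) {a s : Fin N} (hC : C a = C s) (has : u a ≤ u s)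
    (p M L : List (Fin N)) :
    reward g q (attrAux f u C p (a :: (M ++ s :: L))) ≤
      reward g q (attrAux f u C p (s :: (M ++ a :: L))) := by
  have hM : attrAux f u C (p ++ [a]) M = attrAux f u C (p ++ [s]) M :=
    attrAux_congr (fun c => by simp [List.countP_append, hC]) M
  have hL : attrAux f u C (p ++ [a] ++ M ++ [s]) L = attrAux f u C (p ++ [s] ++ M ++ [a]) L :=
    attrAux_congr (fun c => by simp only [List.countP_append]; omega) L
  have hk : (p ++ [a] ++ M).countP (fun j => decide (C j = C s)) =
      (p ++ [s] ++ M).countP (fun j => decide (C j = C s)) := by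
    simp [List.countP_append, hC]
  have hle : p.countP (fun j => decide (C j = C s)) ≤
      (p ++ [s] ++ M).countP (fun j => decide (C j = C s)) := by
    simp only [List.countP_append]
    omega
  simp only [attrAux, attrAux_append, hM, hL, hC, hk]
  refine reward_spread_le hq0 hqg hg1 (mul_le_mul_of_nonneg_left has (hf _).1) ?_ (by ring) _ _
    (attrAux_mem_Icc hf hu _ _) fun z hz => (attrAux_mem_Icc hf hu _ _ z hz).1
  nlinarith [mul_nonneg (sub_nonneg.2 (hf_anti hle)) (sub_nonneg.2 has)]

/-- An item that dominates all others when shown next can be moved to the front of the list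
without decreasing the reward. -/
lemma exists_move_to_front (hq0 : 0 ≤ q) (hqg : q ≤ g) (hg1 : g ≤ 1)
    (hf_anti : Antitone f) (hf : ∀ r, f r ∈ Set.Icc (0 : ℝ) 1)
    (hu : ∀ i, u i ∈ Set.Icc (0 : ℝ) 1) {s : Fin N} {p L : List (Fin N)} (hs : s ∈ L)
    (hcat : ∀ a ∈ L, C a = C s → u a ≤ u s)
    (hdom : ∀ a ∈ L, f (p.countP (fun j => decide (C j = C a))) * u a ≤
      f (p.countP (fun j => decide (C j = C s))) * u s) :
    ∃ T, (s :: T).Perm L ∧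
      reward g q (attrAux f u C p L) ≤ reward g q (attrAux f u C p (s :: T)) := by
  induction L generalizing p with
  | nil => simp at hs
  | cons a L ih =>
    rcases List.mem_cons.mp hs with rfl | hs
    · exact ⟨L, .refl _, le_rfl⟩
    by_cases hC : C a = C s
    · obtain ⟨M, L, rfl⟩ := List.append_of_mem hs
      refine ⟨M ++ a :: L, ?_, reward_exchange_same_category_le hq0 hqg hg1 hf_anti hf hu hC
        (hcat a (by simp) hC) p M L⟩
      exact (List.perm_middle.cons s).trans
        ((List.Perm.swap a s _).trans (List.perm_middle.symm.cons a))
    · have hdom' : ∀ b ∈ L, f ((p ++ [a]).countP (fun j => decide (C j = C b))) * u b ≤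
          f ((p ++ [a]).countP (fun j => decide (C j = C s))) * u s := by
        intro b hb
        have hps : (p ++ [a]).countP (fun j => decide (C j = C s)) =
            p.countP (fun j => decide (C j = C s)) := by
          simp [List.countP_append, hC]
        rw [hps]
        refine le_trans (mul_le_mul_of_nonneg_right (hf_anti ?_) (hu b).1)
          (hdom b (List.mem_cons_of_mem a hb))
        simp only [List.countP_append]
        omega
      obtain ⟨T, hT, hle⟩ := ih hs (fun b hb => hcat b (List.mem_cons_of_mem a hb)) hdom'
      refine ⟨a :: T, (List.Perm.swap a s T).trans (hT.cons a), ?_⟩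
      refine (reward_cons_le_reward_cons hq0 hqg (mul_nonneg (hf _).1 (hu a).1) hle).trans ?_
      have hT' : attrAux f u C (p ++ [a] ++ [s]) T = attrAux f u C (p ++ [s] ++ [a]) T :=
        attrAux_congr (fun c => by simp only [List.countP_append]; omega) T
      have h := reward_swap_le hqg hg1 (hdom a (by simp)) (attrAux f u C (p ++ [s] ++ [a]) T)
      simpa only [attrAux, hT', List.countP_append, List.countP_singleton, hC, Ne.symm hC,
        decide_false, Bool.false_eq_true, if_false, add_zero] using h

lemma reward_attrAux_le_of_perm (hq0 : 0 ≤ q) (hqg : q ≤ g) (hg1 : g ≤ 1)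
    (hf_anti : Antitone f) (hf : ∀ r, f r ∈ Set.Icc (0 : ℝ) 1)
    (hu : ∀ i, u i ∈ Set.Icc (0 : ℝ) 1) {p S S' : List (Fin N)}
    (hcat : S.Pairwise (fun i j => C i = C j → u j ≤ u i))
    (hsorted : (attrAux f u C p S).Pairwise (· ≥ ·)) (hperm : S'.Perm S) :
    reward g q (attrAux f u C p S') ≤ reward g q (attrAux f u C p S) := by
  induction S generalizing p S' with
  | nil => rw [hperm.eq_nil]
  | cons s S ih =>
    have hcat' := List.pairwise_cons.mp hcat
    have hsorted' := List.pairwise_cons.mp hsorted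
    obtain ⟨T, hT, hle⟩ := exists_move_to_front (C := C) (p := p) hq0 hqg hg1 hf_anti hf hu
      (hperm.mem_iff.mpr (by simp : s ∈ s :: S))
      (fun a ha h => by
        rcases List.mem_cons.mp (hperm.mem_iff.mp ha) with rfl | ha
        · exact le_rfl
        · exact hcat'.1 a ha h.symm)
      (fun a ha => head_attr_le (fun r => (hf r).1) hcat
        (List.forall_mem_cons.mpr ⟨le_rfl, hsorted'.1⟩) (hperm.mem_iff.mp ha))
    exact hle.trans (reward_cons_le_reward_cons hq0 hqg (mul_nonneg (hf _).1 (hu s).1)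
      (ih hcat'.2 hsorted'.2 (hT.trans hperm).cons_inv))

end Exchange

/-- An ordering satisfying (i) within each category, more relevant items come first, and
(ii) attractiveness values are nonincreasing along the sequence, maximizes the expected
reward among all orderings of the `N` items. -/
theorem optimal_sequence {N K : ℕ} (g q : ℝ) (hq0 : 0 ≤ q) (hqg : q ≤ g) (hg1 : g ≤ 1)
    (f : ℕ → ℝ) (hf_anti : Antitone f) (hf0 : f 0 = 1)
    (hf_mem : ∀ r, f r ∈ Set.Icc (0 : ℝ) 1)
    (u : Fin N → ℝ) (hu : ∀ i, u i ∈ Set.Icc (0 : ℝ) 1)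
    (C : Fin N → Fin K)
    (S : List (Fin N)) (hS : S.Perm (List.finRange N))
    (hcat : S.Pairwise (fun i j => C i = C j → u j ≤ u i))
    (hsorted : (attrList f u C S).Pairwise (· ≥ ·))
    (S' : List (Fin N)) (hS' : S'.Perm (List.finRange N)) :
    reward g q (attrList f u C S') ≤ reward g q (attrList f u C S) := by
  exact reward_attrAux_le_of_perm hq0 hqg hg1 hf_anti hf_mem hu hcat hsorted
    (hS'.trans hS.symm)
end

section
/- Let z_1 ≥ z_2 ≥ … ≥ z_n be a nonincreasing finite list of values in [0,1]. Then for every permutation σ of {1,…,n}, R_{g,q}(z_1, …, z_n) ≥ R_{g,q}(z_{σ(1)}, …, z_{σ(n)}); that is, among all arrangements of a fixed multiset of attractiveness values, a nonincreasing arrangement maximizes the expected reward. -/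
theorem reward_swap_le_s1 {g q : ℝ} (hq1 : q ≤ 1) {a b : ℝ} (hab : a ≤ b) (l : List ℝ) :
    reward g q (a :: b :: l) ≤ reward g q (b :: a :: l) := by
  simp only [reward]
  linarith [mul_nonneg (sub_nonneg.2 hq1) (sub_nonneg.2 hab)]

theorem reward_cons_le_cons {g q : ℝ} (hq0 : 0 ≤ q) (hqg : q ≤ g) {a : ℝ} (ha : 0 ≤ a)
    {l l' : List ℝ} (h : reward g q l ≤ reward g q l') :
    reward g q (a :: l) ≤ reward g q (a :: l') := by
  have : 0 ≤ (g - q) * a + q := add_nonneg (mul_nonneg (sub_nonneg.2 hqg) ha) hq0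
  simp only [reward]
  gcongr

theorem reward_cons_le_orderedInsert {g q : ℝ} (hq0 : 0 ≤ q) (hqg : q ≤ g) (hq1 : q ≤ 1)
    (a : ℝ) {l : List ℝ} (hl : ∀ x ∈ l, 0 ≤ x) :
    reward g q (a :: l) ≤ reward g q (l.orderedInsert (· ≥ ·) a) := by
  induction l with
  | nil => simp
  | cons b l ih =>
    rw [List.forall_mem_cons] at hl
    rw [List.orderedInsert_cons]
    split_ifs with hab
    · exact le_rfl
    · exact (reward_swap_le_s1 hq1 (not_le.1 hab).le l).trans
        (reward_cons_le_cons hq0 hqg hl.1 (ih hl.2))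

theorem reward_le_insertionSort {g q : ℝ} (hq0 : 0 ≤ q) (hqg : q ≤ g) (hq1 : q ≤ 1)
    {l : List ℝ} (hl : ∀ x ∈ l, 0 ≤ x) :
    reward g q l ≤ reward g q (l.insertionSort (· ≥ ·)) := by
  induction l with
  | nil => simp
  | cons a l ih =>
    rw [List.forall_mem_cons] at hl
    rw [List.insertionSort_cons]
    exact (reward_cons_le_cons hq0 hqg hl.1 (ih hl.2)).trans
      (reward_cons_le_orderedInsert hq0 hqg hq1 a fun x hx =>
        hl.2 x ((List.mem_insertionSort _).1 hx))

/-- Among all arrangements of a fixed multiset of attractiveness values in `[0,1]`,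
a nonincreasing arrangement maximizes the expected reward. -/
theorem sorted_maximizes_reward (g q : ℝ) (hq0 : 0 ≤ q) (hqg : q ≤ g) (hg1 : g ≤ 1)
    (z : List ℝ) (hz : ∀ x ∈ z, x ∈ Set.Icc (0 : ℝ) 1)
    (hsorted : z.Pairwise (· ≥ ·))
    (z' : List ℝ) (hperm : z'.Perm z) :
    reward g q z' ≤ reward g q z := by
  have hsort : z'.insertionSort (· ≥ ·) = z :=
    ((List.perm_insertionSort _ z').trans hperm).eq_of_pairwise'
      (List.pairwise_insertionSort _ z') hsorted
  rw [← hsort]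
  exact reward_le_insertionSort hq0 hqg (hqg.trans hg1) fun x hx => (hz x (hperm.mem_iff.1 hx)).1
end
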